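/- Let f ∈ Γ₀(ℝⁿ) with ri(dom f) ∩ U ≠ ∅ (ri denoting relative interior), and let λ > 0. Then for every x ∈ U, prox^φ_λ f(x) = ∇φ*( ∇φ(x) − λ·aprox^{(1/λ)⋆φ*}(f*)( ∇φ(x)/λ ) ); equivalently, ∇φ( prox^φ_λ f(x) ) + λ·aprox^{(1/λ)⋆φ*}(f*)( ∇φ(x)/λ ) = ∇φ(x) for every x ∈ U. -/

import Mathlib

open scoped RealInnerProductSpace Pointwise Topology Classical

noncomputable section

/-- Effective domain of an extended-real-valued function. -/
def edom {n : ℕ} (f : EuclideanSpace ℝ (Fin n) → EReal) : Set (EuclideanSpace ℝ (Fin n)) :=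
  {x | f x ≠ ⊤}

/-- Proper: nowhere `⊥` and not identically `⊤`. -/
def ProperFn {n : ℕ} (f : EuclideanSpace ℝ (Fin n) → EReal) : Prop :=
  (∀ x, f x ≠ ⊥) ∧ ∃ x, f x ≠ ⊤

/-- Convexity for extended-real-valued functions. -/
def ConvexFn {n : ℕ} (f : EuclideanSpace ℝ (Fin n) → EReal) : Prop :=
  ∀ x y : EuclideanSpace ℝ (Fin n), ∀ a b : ℝ, 0 ≤ a → 0 ≤ b → a + b = 1 →
    f (a • x + b • y) ≤ (a : EReal) * f x + (b : EReal) * f y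

/-- `Γ₀`: proper, lower semicontinuous, convex. -/
def Gamma0 {n : ℕ} (f : EuclideanSpace ℝ (Fin n) → EReal) : Prop :=
  ProperFn f ∧ LowerSemicontinuous f ∧ ConvexFn f

/-- Fenchel conjugate. -/
def fconj {n : ℕ} (f : EuclideanSpace ℝ (Fin n) → EReal) (y : EuclideanSpace ℝ (Fin n)) :
    EReal :=
  ⨆ x, ((⟪y, x⟫ : ℝ) : EReal) - f x

/-- Convex subdifferential. -/
def subdiff {n : ℕ} (f : EuclideanSpace ℝ (Fin n) → EReal) (x : EuclideanSpace ℝ (Fin n)) :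
    Set (EuclideanSpace ℝ (Fin n)) :=
  {u | ∀ y, f x + ((⟪u, y - x⟫ : ℝ) : EReal) ≤ f y}

/-- 1-coercive (supercoercive): `f x / ‖x‖ → ∞` as `‖x‖ → ∞`. -/
def SuperCoercive {n : ℕ} (f : EuclideanSpace ℝ (Fin n) → EReal) : Prop :=
  ∀ c : ℝ, ∃ R : ℝ, ∀ x, R ≤ ‖x‖ → ((c * ‖x‖ : ℝ) : EReal) ≤ f x

/-- Legendre-type function `φ` with gradient map `gφ` on `U = int (dom φ)`:
proper, lsc, convex, `U ≠ ∅`, differentiable on `U`, essentially smooth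
(gradient blows up along sequences approaching the boundary), and
essentially strictly convex (strictly convex on `U`). -/
structure IsLegendre {n : ℕ} (φ : EuclideanSpace ℝ (Fin n) → EReal)
    (gφ : EuclideanSpace ℝ (Fin n) → EuclideanSpace ℝ (Fin n)) : Prop where
  proper : ProperFn φ
  lsc : LowerSemicontinuous φ
  convex : ConvexFn φ
  intNonempty : (interior (edom φ)).Nonempty
  grad : ∀ x ∈ interior (edom φ), HasGradientAt (fun y => (φ y).toReal) (gφ x) x
  essSmooth : ∀ (u : ℕ → EuclideanSpace ℝ (Fin n)) (x : EuclideanSpace ℝ (Fin n)),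
      (∀ k, u k ∈ interior (edom φ)) → x ∈ frontier (edom φ) →
      Filter.Tendsto u Filter.atTop (nhds x) →
      Filter.Tendsto (fun k => ‖gφ (u k)‖) Filter.atTop Filter.atTop
  essStrictConvex : ∀ x ∈ interior (edom φ), ∀ y ∈ interior (edom φ), x ≠ y →
      ∀ a b : ℝ, 0 < a → 0 < b → a + b = 1 →
      φ (a • x + b • y) < (a : EReal) * φ x + (b : EReal) * φ y

/-- Bregman distance `D_φ`. -/
def bregman {n : ℕ} (φ : EuclideanSpace ℝ (Fin n) → EReal)
    (gφ : EuclideanSpace ℝ (Fin n) → EuclideanSpace ℝ (Fin n))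
    (x y : EuclideanSpace ℝ (Fin n)) : EReal :=
  if y ∈ interior (edom φ) then φ x - φ y - ((⟪gφ y, x - y⟫ : ℝ) : EReal) else ⊤

/-- Left Bregman envelope `env^φ_λ f`. -/
def benv {n : ℕ} (φ : EuclideanSpace ℝ (Fin n) → EReal)
    (gφ : EuclideanSpace ℝ (Fin n) → EuclideanSpace ℝ (Fin n)) (lam : ℝ)
    (f : EuclideanSpace ℝ (Fin n) → EReal) (y : EuclideanSpace ℝ (Fin n)) : EReal :=
  ⨅ x, f x + ((1 / lam : ℝ) : EReal) * bregman φ gφ x y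

/-- Left Bregman proximal map `prox^φ_λ f` (set of minimizers). -/
def bprox {n : ℕ} (φ : EuclideanSpace ℝ (Fin n) → EReal)
    (gφ : EuclideanSpace ℝ (Fin n) → EuclideanSpace ℝ (Fin n)) (lam : ℝ)
    (f : EuclideanSpace ℝ (Fin n) → EReal) (y : EuclideanSpace ℝ (Fin n)) :
    Set (EuclideanSpace ℝ (Fin n)) :=
  {x | f x + ((1 / lam : ℝ) : EReal) * bregman φ gφ x y ≠ ⊤ ∧
    ∀ z, f x + ((1 / lam : ℝ) : EReal) * bregman φ gφ x y ≤
      f z + ((1 / lam : ℝ) : EReal) * bregman φ gφ z y}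

/-- φ-prox-boundedness threshold `λ_f`. -/
def proxThreshold {n : ℕ} (φ : EuclideanSpace ℝ (Fin n) → EReal)
    (gφ : EuclideanSpace ℝ (Fin n) → EuclideanSpace ℝ (Fin n))
    (f : EuclideanSpace ℝ (Fin n) → EReal) : EReal :=
  sSup ((fun lam : ℝ => (lam : EReal)) ''
    {lam : ℝ | 0 < lam ∧ ∃ x, benv φ gφ lam f x ≠ ⊥})

/-- λ-φ-proximal hull: pointwise supremum of all minorants `c - (1/λ) D_φ(·, w)`. -/
def phull {n : ℕ} (φ : EuclideanSpace ℝ (Fin n) → EReal)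
    (gφ : EuclideanSpace ℝ (Fin n) → EuclideanSpace ℝ (Fin n)) (lam : ℝ)
    (f : EuclideanSpace ℝ (Fin n) → EReal) (x : EuclideanSpace ℝ (Fin n)) : EReal :=
  ⨆ (c : ℝ) (w : EuclideanSpace ℝ (Fin n)) (_ : w ∈ interior (edom φ))
    (_ : ∀ z, (c : EReal) - ((1 / lam : ℝ) : EReal) * bregman φ gφ z w ≤ f z),
    ((c : EReal) - ((1 / lam : ℝ) : EReal) * bregman φ gφ x w)

/-- Combettes–Reyes anisotropic envelope `f □ ψ`. -/
def aenv {n : ℕ} (ψ f : EuclideanSpace ℝ (Fin n) → EReal) (x : EuclideanSpace ℝ (Fin n)) :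
    EReal :=
  ⨅ y, f y + ψ (x - y)

/-- Combettes–Reyes anisotropic proximal map `aprox^ψ f`. -/
def aprox {n : ℕ} (ψ f : EuclideanSpace ℝ (Fin n) → EReal) (x : EuclideanSpace ℝ (Fin n)) :
    Set (EuclideanSpace ℝ (Fin n)) :=
  {y | f y + ψ (x - y) ≠ ⊤ ∧ ∀ z, f y + ψ (x - y) ≤ f z + ψ (x - z)}

/-- Subtraction with the conventions `⊤ - ⊤ = ⊤` and `⊤ - r = ⊤`. -/
def esub (a b : EReal) : EReal := if a = ⊤ then ⊤ else a - b

/-- Convex hull of a function: the largest convex minorant. -/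
def convFn {n : ℕ} (f : EuclideanSpace ℝ (Fin n) → EReal) (x : EuclideanSpace ℝ (Fin n)) :
    EReal :=
  ⨆ (g : EuclideanSpace ℝ (Fin n) → EReal) (_ : ConvexFn g ∧ ∀ y, g y ≤ f y), g x

/-- Epi-multiplication `μ ⋆ g`. -/
def epiMul {n : ℕ} (μ : ℝ) (g : EuclideanSpace ℝ (Fin n) → EReal)
    (x : EuclideanSpace ℝ (Fin n)) : EReal :=
  if 0 < μ then (μ : EReal) * g ((1 / μ) • x) else (if x = 0 then 0 else ⊤)

/-- Infimal convolution. -/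
def infConv {n : ℕ} (g h : EuclideanSpace ℝ (Fin n) → EReal)
    (x : EuclideanSpace ℝ (Fin n)) : EReal :=
  ⨅ u, g u + h (x - u)

/-- The α-weighted Bregman proximal average with parameter λ. -/
def pavg {n : ℕ} (φ : EuclideanSpace ℝ (Fin n) → EReal) (lam α : ℝ)
    (f1 f2 : EuclideanSpace ℝ (Fin n) → EReal) (x : EuclideanSpace ℝ (Fin n)) : EReal :=
  esub
    (fconj (fun y =>
      (α : EReal) * fconj (fun z => f1 z + ((1 / lam : ℝ) : EReal) * φ z) y
        + ((1 - α : ℝ) : EReal) * fconj (fun z => f2 z + ((1 / lam : ℝ) : EReal) * φ z) y) x)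
    (((1 / lam : ℝ) : EReal) * φ x)

/-- Argmin set of an extended-real-valued function. -/
def argminSet {n : ℕ} (f : EuclideanSpace ℝ (Fin n) → EReal) :
    Set (EuclideanSpace ℝ (Fin n)) :=
  {x | f x ≠ ⊤ ∧ ∀ y, f x ≤ f y}

lemma HasGradientAt.le_inner_of_eventually {n : ℕ} {H : EuclideanSpace ℝ (Fin n) → ℝ}
    {g q d : EuclideanSpace ℝ (Fin n)} {c : ℝ} (hg : HasGradientAt H g q)
    (h : ∀ᶠ t in 𝓝[>] (0 : ℝ), c * t ≤ H (q + t • d) - H q) : c ≤ ⟪g, d⟫ := by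
  have hline : HasDerivAt (fun t : ℝ => q + t • d) d 0 := by
    simpa using ((hasDerivAt_id (0 : ℝ)).smul_const d).const_add q
  have hcomp : HasDerivAt (fun t : ℝ => H (q + t • d)) ⟪g, d⟫ 0 := by
    have h1 : HasFDerivAt H ((InnerProductSpace.toDual ℝ _) g) (q + (0 : ℝ) • d) := by
      simpa using hg.hasFDerivAt
    have h2 := h1.comp_hasDerivAt (0 : ℝ) hline
    rw [InnerProductSpace.toDual_apply_apply] at h2
    exact h2
  refine ge_of_tendsto hcomp.tendsto_slope_zero_right ?_
  filter_upwards [h, self_mem_nhdsWithin] with t ht ht0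
  have ht0 : 0 < t := ht0
  simp only [zero_add, zero_smul, add_zero, smul_eq_mul]
  rw [inv_mul_eq_div, le_div_iff₀ ht0]
  exact ht

lemma HasGradientAt.eq_of_eventually_inner_le {n : ℕ} {H : EuclideanSpace ℝ (Fin n) → ℝ}
    {g u q : EuclideanSpace ℝ (Fin n)} (hg : HasGradientAt H g q)
    (h : ∀ᶠ w in 𝓝 q, ⟪u, w - q⟫ ≤ H w - H q) : u = g := by
  have key : ⟪u, u - g⟫ ≤ ⟪g, u - g⟫ := by
    refine hg.le_inner_of_eventually ?_
    have ht : Filter.Tendsto (fun t : ℝ => q + t • (u - g)) (𝓝[>] 0) (𝓝 q) := by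
      have : Continuous (fun t : ℝ => q + t • (u - g)) := by fun_prop
      simpa using (this.tendsto 0).mono_left nhdsWithin_le_nhds
    filter_upwards [ht.eventually h] with t ht
    simpa [inner_smul_right, mul_comm] using ht
  have : ⟪u - g, u - g⟫ ≤ 0 := by rw [inner_sub_left]; linarith
  rw [real_inner_self_eq_norm_sq] at this
  exact sub_eq_zero.1 (norm_eq_zero.1 (pow_eq_zero_iff two_ne_zero |>.1
    (le_antisymm this (sq_nonneg _))))

lemma EReal.exists_coe_eq {a : EReal} (h : a ≠ ⊥) (h' : a ≠ ⊤) : ∃ r : ℝ, a = r :=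
  ⟨a.toReal, (EReal.coe_toReal h' h).symm⟩

lemma ConvexFn.exists_le_segment {n : ℕ} {f : EuclideanSpace ℝ (Fin n) → EReal}
    (hf : ConvexFn f) (hbot : ∀ x, f x ≠ ⊥) {x y : EuclideanSpace ℝ (Fin n)} {a b t : ℝ}
    (hx : f x = a) (hy : f y = b) (h0 : 0 ≤ t) (h1 : t ≤ 1) :
    ∃ r : ℝ, f (x + t • (y - x)) = r ∧ r ≤ (1 - t) * a + t * b := by
  have h := hf x y (1 - t) t (by linarith) h0 (by ring)
  have e : (1 - t) • x + t • y = x + t • (y - x) := by module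
  rw [e, hx, hy] at h
  norm_cast at h
  obtain ⟨r, hr⟩ := EReal.exists_coe_eq (hbot (x + t • (y - x)))
    (ne_top_of_le_ne_top (EReal.coe_ne_top _) h)
  rw [hr] at h
  exact ⟨r, hr, by exact_mod_cast h⟩

lemma ConvexFn.convex_edom {n : ℕ} {f : EuclideanSpace ℝ (Fin n) → EReal}
    (hf : ConvexFn f) (hbot : ∀ x, f x ≠ ⊥) : Convex ℝ (edom f) := by
  rw [convex_iff_add_mem]
  intro x hx y hy a b ha hb hab
  obtain ⟨r, hr⟩ := EReal.exists_coe_eq (hbot x) hx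
  obtain ⟨s, hs⟩ := EReal.exists_coe_eq (hbot y) hy
  obtain ⟨c, hc, -⟩ := hf.exists_le_segment hbot hr hs hb (by linarith)
  have e : a • x + b • y = x + b • (y - x) := by
    rw [show a = 1 - b by linarith]; module
  simp [edom, e, hc]

lemma mem_subdiff_iff {n : ℕ} {f : EuclideanSpace ℝ (Fin n) → EReal} (hbot : ∀ x, f x ≠ ⊥)
    {x u : EuclideanSpace ℝ (Fin n)} {a : ℝ} (hx : f x = a) :
    u ∈ subdiff f x ↔ ∀ (y : EuclideanSpace ℝ (Fin n)) (b : ℝ), f y = b → a + ⟪u, y - x⟫ ≤ b := by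
  constructor
  · intro h y b hy
    have := h y
    rw [hx, hy] at this
    exact_mod_cast this
  · intro h y
    by_cases hy : f y = ⊤
    · simp [hy]
    · obtain ⟨b, hb⟩ := EReal.exists_coe_eq (hbot y) hy
      rw [hx, hb]
      exact_mod_cast h y b hb

lemma fconj_le_iff {n : ℕ} {f : EuclideanSpace ℝ (Fin n) → EReal} (hbot : ∀ x, f x ≠ ⊥)
    {u : EuclideanSpace ℝ (Fin n)} {r : ℝ} :
    fconj f u ≤ r ↔
      ∀ (y : EuclideanSpace ℝ (Fin n)) (b : ℝ), f y = b → ⟪u, y⟫ - b ≤ r := by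
  rw [fconj, iSup_le_iff]
  refine forall_congr' fun y => ?_
  constructor
  · intro h b hb
    rw [hb] at h
    exact_mod_cast h
  · intro h
    by_cases hy : f y = ⊤
    · simp [hy]
    · obtain ⟨b, hb⟩ := EReal.exists_coe_eq (hbot y) hy
      rw [hb]
      exact_mod_cast h b hb

lemma le_fconj {n : ℕ} {f : EuclideanSpace ℝ (Fin n) → EReal}
    {x : EuclideanSpace ℝ (Fin n)} {a : ℝ} (hx : f x = a) (u : EuclideanSpace ℝ (Fin n)) :
    ((⟪u, x⟫ - a : ℝ) : EReal) ≤ fconj f u := by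
  have := le_iSup (fun x => ((⟪u, x⟫ : ℝ) : EReal) - f x) x
  rw [hx] at this
  exact_mod_cast this

lemma fconj_eq_iff_mem_subdiff {n : ℕ} {f : EuclideanSpace ℝ (Fin n) → EReal}
    (hbot : ∀ x, f x ≠ ⊥) {x u : EuclideanSpace ℝ (Fin n)} {a : ℝ} (hx : f x = a) :
    fconj f u = ((⟪u, x⟫ - a : ℝ) : EReal) ↔ u ∈ subdiff f x := by
  rw [mem_subdiff_iff hbot hx]
  constructor
  · intro h y b hb
    have := (fconj_le_iff hbot).1 h.le y b hb
    rw [inner_sub_right]; linarith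
  · intro h
    refine le_antisymm ((fconj_le_iff hbot).2 fun y b hb => ?_) (le_fconj hx u)
    have := h y b hb
    rw [inner_sub_right] at this; linarith

lemma IsLegendre.gradient_mem_subdiff {n : ℕ} {φ : EuclideanSpace ℝ (Fin n) → EReal}
    {gφ : EuclideanSpace ℝ (Fin n) → EuclideanSpace ℝ (Fin n)} (hφ : IsLegendre φ gφ)
    {y : EuclideanSpace ℝ (Fin n)} (hy : y ∈ interior (edom φ)) : gφ y ∈ subdiff φ y := by
  have hbot := hφ.proper.1
  obtain ⟨a, ha⟩ := EReal.exists_coe_eq (hbot y) (interior_subset hy)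
  rw [mem_subdiff_iff hbot ha]
  intro z b hb
  have hneg : HasGradientAt (fun w => -(φ w).toReal) (-gφ y) y := by
    rw [hasGradientAt_iff_hasFDerivAt, map_neg]
    exact (hφ.grad y hy).hasFDerivAt.neg
  have key : a - b ≤ ⟪-gφ y, z - y⟫ := by
    refine hneg.le_inner_of_eventually ?_
    filter_upwards [Ioc_mem_nhdsGT (zero_lt_one' ℝ)] with t ht
    obtain ⟨r, hr, hle⟩ := hφ.convex.exists_le_segment hbot ha hb ht.1.le ht.2
    simp only [hr, ha, EReal.toReal_coe]
    linarith
  rw [inner_neg_left] at key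
  linarith

lemma IsLegendre.eq_gradient_of_mem_subdiff {n : ℕ} {φ : EuclideanSpace ℝ (Fin n) → EReal}
    {gφ : EuclideanSpace ℝ (Fin n) → EuclideanSpace ℝ (Fin n)} (hφ : IsLegendre φ gφ)
    {y v : EuclideanSpace ℝ (Fin n)} (hy : y ∈ interior (edom φ)) (hv : v ∈ subdiff φ y) :
    v = gφ y := by
  have hbot := hφ.proper.1
  obtain ⟨a, ha⟩ := EReal.exists_coe_eq (hbot y) (interior_subset hy)
  rw [mem_subdiff_iff hbot ha] at hv
  refine (hφ.grad y hy).eq_of_eventually_inner_le ?_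
  filter_upwards [isOpen_interior.mem_nhds hy] with w hw
  obtain ⟨b, hb⟩ := EReal.exists_coe_eq (hbot w) (interior_subset hw)
  have := hv w b hb
  simp only [ha, hb, EReal.toReal_coe]
  linarith

/-- A point of the domain of a Legendre function from which the function does not decrease
infinitely fast towards some interior point is itself interior. -/
lemma IsLegendre.mem_interior_of_segment_bound {n : ℕ}
    {φ : EuclideanSpace ℝ (Fin n) → EReal}
    {gφ : EuclideanSpace ℝ (Fin n) → EuclideanSpace ℝ (Fin n)} (hφ : IsLegendre φ gφ)
    {q x : EuclideanSpace ℝ (Fin n)} (hx : x ∈ interior (edom φ)) {b C : ℝ} (hq : φ q = b)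
    (h : ∀ t r : ℝ, 0 < t → t ≤ 1 → φ (q + t • (x - q)) = r → b + t * C ≤ r) :
    q ∈ interior (edom φ) := by
  by_contra hqU
  have hbot := hφ.proper.1
  have hqdom : q ∈ edom φ := by simp [edom, hq]
  have hseg : ∀ t : ℝ, 0 < t → t ≤ 1 → q + t • (x - q) ∈ interior (edom φ) := fun t h0 h1 =>
    (hφ.convex.convex_edom hbot).add_smul_sub_mem_interior hqdom hx ⟨h0, h1⟩
  obtain ⟨ρ, hρ, M, hM⟩ : ∃ ρ > 0, ∃ M : ℝ, ∀ w, ‖w - x‖ ≤ ρ → ∃ s : ℝ, φ w = s ∧ s ≤ M := by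
    have hcont := (hφ.grad x hx).hasFDerivAt.continuousAt
    have hev : ∀ᶠ w in 𝓝 x, (φ w).toReal < (φ x).toReal + 1 ∧ w ∈ interior (edom φ) :=
      (hcont.eventually_lt continuousAt_const (by simp)).and (isOpen_interior.mem_nhds hx)
    obtain ⟨ε, hε, hball⟩ := Metric.eventually_nhds_iff.1 hev
    refine ⟨ε / 2, by positivity, (φ x).toReal + 1, fun w hw => ?_⟩
    have hw' := hball (y := w) (by rw [dist_eq_norm]; linarith)
    exact ⟨_, (EReal.coe_toReal (interior_subset hw'.2) (hbot w)).symm, hw'.1.le⟩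
  have hbound : ∀ t : ℝ, 0 < t → t ≤ 1 → ρ * ‖gφ (q + t • (x - q))‖ ≤ M - b - C := by
    intro t h0 h1
    have hu := hseg t h0 h1
    set u := q + t • (x - q) with hu_def
    set g := gφ u
    obtain ⟨r, hr⟩ := EReal.exists_coe_eq (hbot u) (interior_subset hu)
    have hsub := (mem_subdiff_iff hbot hr).1 (hφ.gradient_mem_subdiff hu)
    have hnorm : ‖(ρ * ‖g‖⁻¹) • g‖ ≤ ρ := by
      rw [norm_smul, Real.norm_of_nonneg (by positivity), mul_assoc]
      exact mul_le_of_le_one_right hρ.le (inv_mul_le_one_of_le₀ le_rfl (norm_nonneg g))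
    obtain ⟨s, hs, hsM⟩ := hM (x + (ρ * ‖g‖⁻¹) • g) (by simpa using hnorm)
    have e1 := hsub _ s hs
    have e2 := hsub q b hq
    have e3 := h t r h0 h1 hr
    have d1 : x + (ρ * ‖g‖⁻¹) • g - u = (ρ * ‖g‖⁻¹) • g + (1 - t) • (x - q) := by
      rw [hu_def]; module
    have d2 : q - u = (-t) • (x - q) := by rw [hu_def]; module
    have d3 : ρ * ‖g‖⁻¹ * ⟪g, g⟫ = ρ * ‖g‖ := by
      rw [real_inner_self_eq_norm_sq]
      rcases eq_or_ne ‖g‖ 0 with h | h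
      · simp [h]
      · field_simp
    change r + ⟪g, _⟫ ≤ s at e1
    change r + ⟪g, _⟫ ≤ b at e2
    rw [d1, inner_add_right, inner_smul_right, inner_smul_right, d3] at e1
    rw [d2, inner_smul_right] at e2
    have e4 : C ≤ ⟪g, x - q⟫ := by
      by_contra! hc
      nlinarith
    nlinarith [mul_le_mul_of_nonneg_left e4 (sub_nonneg.2 h1)]
  have hpos : ∀ k : ℕ, (0 : ℝ) < 1 / ((k : ℝ) + 1) := fun k => Nat.one_div_pos_of_nat
  have hle : ∀ k : ℕ, 1 / ((k : ℝ) + 1) ≤ 1 := fun k => by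
    rw [div_le_one (by positivity)]; linarith [Nat.cast_nonneg (α := ℝ) k]
  have hlim : Filter.Tendsto (fun k : ℕ => q + (1 / ((k : ℝ) + 1)) • (x - q)) Filter.atTop
      (𝓝 q) := by
    simpa using (tendsto_one_div_add_atTop_nhds_zero_nat (𝕜 := ℝ)).smul_const (x - q)
      |>.const_add q
  have htop := hφ.essSmooth _ q (fun k => hseg _ (hpos k) (hle k))
    ⟨subset_closure hqdom, hqU⟩ hlim
  obtain ⟨k, hk⟩ := (htop.eventually_gt_atTop ((M - b - C) / ρ)).exists
  rw [div_lt_iff₀ hρ] at hk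
  linarith [hbound _ (hpos k) (hle k)]

lemma Gamma0.exists_norm_minorant {n : ℕ} {f : EuclideanSpace ℝ (Fin n) → EReal}
    (hf : Gamma0 f) : ∃ c d : ℝ, ∀ z, ((-(c * ‖z‖) - d : ℝ) : EReal) ≤ f z := by
  obtain ⟨⟨hbot, x, hx⟩, hlsc, hconv⟩ := hf
  obtain ⟨a, ha⟩ := EReal.exists_coe_eq (hbot x) hx
  obtain ⟨w, -, hw⟩ := LowerSemicontinuousOn.exists_isMinOn
    (Metric.nonempty_closedBall.2 (zero_le_one' ℝ)) (isCompact_closedBall x (1 : ℝ))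
    (hlsc.lowerSemicontinuousOn _)
  have hwx : f w ≤ f x := hw (Metric.mem_closedBall_self zero_le_one)
  obtain ⟨m, hm⟩ := EReal.exists_coe_eq (hbot w) (ne_top_of_le_ne_top hx hwx)
  have hma : m ≤ a := by rw [hm, ha] at hwx; exact_mod_cast hwx
  refine ⟨a - m, (a - m) * ‖x‖ + |a| + |m|, fun z => ?_⟩
  by_cases hz : f z = ⊤
  · simp [hz]
  obtain ⟨b, hb⟩ := EReal.exists_coe_eq (hbot z) hz
  rw [hb, EReal.coe_le_coe_iff]
  have hn := norm_nonneg z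
  have hn' := norm_nonneg x
  have hN : ‖z - x‖ ≤ ‖z‖ + ‖x‖ := norm_sub_le z x
  have h0 := mul_nonneg (sub_nonneg.2 hma) hn
  have h0' := mul_nonneg (sub_nonneg.2 hma) hn'
  rcases le_or_gt ‖z - x‖ 1 with h1 | h1
  · have hz' : f w ≤ f z := hw (by simpa [dist_eq_norm] using h1)
    rw [hm, hb, EReal.coe_le_coe_iff] at hz'
    linarith [neg_abs_le m, abs_nonneg a]
  · have hpos : 0 < ‖z - x‖ := by linarith
    obtain ⟨r, hr, hle⟩ := hconv.exists_le_segment hbot ha hb (t := ‖z - x‖⁻¹)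
      (by positivity) (inv_le_one_of_one_le₀ h1.le)
    have hmr : f w ≤ f (x + ‖z - x‖⁻¹ • (z - x)) := hw (by
      simp [dist_eq_norm, norm_smul, hpos.ne'])
    rw [hm, hr, EReal.coe_le_coe_iff] at hmr
    have h2 : ‖z - x‖ * m ≤ (‖z - x‖ - 1) * a + b := by
      calc ‖z - x‖ * m ≤ ‖z - x‖ * ((1 - ‖z - x‖⁻¹) * a + ‖z - x‖⁻¹ * b) := by
            gcongr; linarith
        _ = (‖z - x‖ - 1) * a + b := by field_simp
    nlinarith [mul_le_mul_of_nonneg_left hN (sub_nonneg.2 hma), neg_abs_le a, abs_nonneg m]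

lemma SuperCoercive.exists_norm_minorant {n : ℕ} {φ : EuclideanSpace ℝ (Fin n) → EReal}
    (hco : SuperCoercive φ) (hφ : Gamma0 φ) (C : ℝ) :
    ∃ D : ℝ, ∀ z, ((C * ‖z‖ - D : ℝ) : EReal) ≤ φ z := by
  obtain ⟨c, d, hcd⟩ := hφ.exists_norm_minorant
  obtain ⟨R, hR⟩ := hco C
  refine ⟨|C + c| * |R| + |d|, fun z => ?_⟩
  have hn := norm_nonneg z
  rcases le_or_gt R ‖z‖ with h | h
  · refine le_trans (EReal.coe_le_coe_iff.2 ?_) (hR z h)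
    have : 0 ≤ |C + c| * |R| := by positivity
    linarith [abs_nonneg d]
  · refine le_trans (EReal.coe_le_coe_iff.2 ?_) (hcd z)
    have h1 : (C + c) * ‖z‖ ≤ |C + c| * |R| := by
      have := le_abs_self (C + c)
      have := le_abs_self R
      exact mul_le_mul ‹_› (by linarith) hn (abs_nonneg _)
    linarith [le_abs_self d]

lemma SuperCoercive.fconj_ne_top {n : ℕ} {φ : EuclideanSpace ℝ (Fin n) → EReal}
    (hco : SuperCoercive φ) (hφ : Gamma0 φ) (u : EuclideanSpace ℝ (Fin n)) : fconj φ u ≠ ⊤ := by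
  obtain ⟨D, hD⟩ := hco.exists_norm_minorant hφ ‖u‖
  refine ne_top_of_le_ne_top (EReal.coe_ne_top D) ((fconj_le_iff hφ.1.1).2 fun y b hb => ?_)
  have h1 := hD y
  rw [hb, EReal.coe_le_coe_iff] at h1
  linarith [real_inner_le_norm u y]

lemma SuperCoercive.eq_gradient_fconj {n : ℕ} {φ : EuclideanSpace ℝ (Fin n) → EReal}
    (hco : SuperCoercive φ) (hφ : Gamma0 φ) {x u g : EuclideanSpace ℝ (Fin n)} {a : ℝ}
    (hx : φ x = a) (hu : u ∈ subdiff φ x)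
    (hg : HasGradientAt (fun z => (fconj φ z).toReal) g u) : x = g := by
  refine hg.eq_of_eventually_inner_le (Filter.Eventually.of_forall fun w => ?_)
  have hw := le_fconj hx w
  rw [← EReal.coe_toReal (hco.fconj_ne_top hφ w)
    (ne_bot_of_le_ne_bot (EReal.coe_ne_bot _) hw), EReal.coe_le_coe_iff] at hw
  rw [(fconj_eq_iff_mem_subdiff hφ.1.1 hx).2 hu, EReal.toReal_coe, inner_sub_right,
    real_inner_comm w, real_inner_comm u]
  linarith

lemma LowerSemicontinuous.exists_forall_le_of_norm_le {n : ℕ}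
    {F : EuclideanSpace ℝ (Fin n) → EReal} (hF : LowerSemicontinuous F)
    {x : EuclideanSpace ℝ (Fin n)} {a D : ℝ} (hx : F x = a)
    (hD : ∀ z, ((‖z‖ - D : ℝ) : EReal) ≤ F z) : ∃ q, ∀ z, F q ≤ F z := by
  have hxmem : x ∈ Metric.closedBall (0 : EuclideanSpace ℝ (Fin n)) (max ‖x‖ (a + D)) := by simp
  obtain ⟨q, -, hq⟩ := LowerSemicontinuousOn.exists_isMinOn ⟨x, hxmem⟩
    (isCompact_closedBall _ _) (hF.lowerSemicontinuousOn _)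
  refine ⟨q, fun z => ?_⟩
  by_cases hz : ‖z‖ ≤ max ‖x‖ (a + D)
  · exact hq (by simpa using hz)
  · refine le_trans (hq hxmem) (le_trans ?_ (hD z))
    rw [hx, EReal.coe_le_coe_iff]
    have := le_max_right ‖x‖ (a + D)
    linarith

lemma mul_bregman_eq {n : ℕ} {φ : EuclideanSpace ℝ (Fin n) → EReal}
    {gφ : EuclideanSpace ℝ (Fin n) → EuclideanSpace ℝ (Fin n)}
    {x : EuclideanSpace ℝ (Fin n)} (hx : x ∈ interior (edom φ)) {c μ : ℝ} (hc : φ x = c)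
    (hμ : 0 < μ) (hbot : ∀ z, φ z ≠ ⊥) (z : EuclideanSpace ℝ (Fin n)) :
    (μ : EReal) * bregman φ gφ z x =
      (μ : EReal) * φ z + ((μ * (-c - ⟪gφ x, z - x⟫) : ℝ) : EReal) := by
  rw [bregman, if_pos hx, hc]
  by_cases hz : φ z = ⊤
  · rw [hz, EReal.top_sub_coe, EReal.top_sub_coe, EReal.coe_mul_top_of_pos hμ, EReal.top_add_coe]
  · obtain ⟨b, hb⟩ := EReal.exists_coe_eq (hbot z) hz
    rw [hb]
    norm_cast
    ring

lemma lowerSemicontinuous_add_mul_bregman {n : ℕ} {φ f : EuclideanSpace ℝ (Fin n) → EReal}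
    {gφ : EuclideanSpace ℝ (Fin n) → EuclideanSpace ℝ (Fin n)}
    (hφ : LowerSemicontinuous φ) (hφbot : ∀ z, φ z ≠ ⊥) (hf : LowerSemicontinuous f)
    (hfbot : ∀ z, f z ≠ ⊥) {x : EuclideanSpace ℝ (Fin n)} (hx : x ∈ interior (edom φ)) {μ : ℝ}
    (hμ : 0 < μ) : LowerSemicontinuous fun z => f z + (μ : EReal) * bregman φ gφ z x := by
  obtain ⟨c, hc⟩ := EReal.exists_coe_eq (hφbot x) (interior_subset hx)
  simp only [mul_bregman_eq hx hc hμ hφbot]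
  have hmul : ∀ z, (μ : EReal) * φ z ≠ ⊥ := fun z => by
    by_cases hz : φ z = ⊤
    · rw [hz, EReal.coe_mul_top_of_pos hμ]; simp
    · obtain ⟨b, hb⟩ := EReal.exists_coe_eq (hφbot z) hz
      rw [hb]; norm_cast; exact EReal.coe_ne_bot _
  have hcont : Continuous fun t : EReal => (μ : EReal) * t :=
    continuous_iff_continuousAt.2 fun t =>
      ContinuousAt.comp (f := fun t : EReal => ((μ : EReal), t)) (EReal.continuousAt_mul
        (by simp [hμ.ne']) (by simp [hμ.ne']) (by simp) (by simp)) (by fun_prop)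
  have h1 : LowerSemicontinuous fun z => (μ : EReal) * φ z :=
    hcont.comp_lowerSemicontinuous hφ fun a b hab =>
      mul_le_mul_of_nonneg_left hab (EReal.coe_nonneg.2 hμ.le)
  have h2 : LowerSemicontinuous fun z => ((μ * (-c - ⟪gφ x, z - x⟫) : ℝ) : EReal) :=
    (continuous_coe_real_ereal.comp (by fun_prop)).lowerSemicontinuous
  have h3 := h1.add' h2 fun z => EReal.continuousAt_add (Or.inr (EReal.coe_ne_bot _)) (Or.inl (hmul z))
  refine hf.add' h3 fun z => EReal.continuousAt_add (Or.inr ?_) (Or.inl (hfbot z))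
  exact fun h => (EReal.add_eq_bot_iff.1 h).elim (hmul z) (EReal.coe_ne_bot _)

lemma add_mul_bregman_eq {n : ℕ} {φ f : EuclideanSpace ℝ (Fin n) → EReal}
    {gφ : EuclideanSpace ℝ (Fin n) → EuclideanSpace ℝ (Fin n)}
    {x z : EuclideanSpace ℝ (Fin n)} (hx : x ∈ interior (edom φ)) {a b c : ℝ} (hc : φ x = c)
    (ha : f z = a) (hb : φ z = b) (μ : ℝ) :
    f z + (μ : EReal) * bregman φ gφ z x =
      ((a + μ * (b - c - ⟪gφ x, z - x⟫) : ℝ) : EReal) := by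
  rw [bregman, if_pos hx, ha, hb, hc]
  norm_cast

lemma exists_coe_of_add_mul_bregman_ne_top {n : ℕ} {φ f : EuclideanSpace ℝ (Fin n) → EReal}
    {gφ : EuclideanSpace ℝ (Fin n) → EuclideanSpace ℝ (Fin n)}
    (hφbot : ∀ z, φ z ≠ ⊥) (hfbot : ∀ z, f z ≠ ⊥) {x z : EuclideanSpace ℝ (Fin n)}
    (hx : x ∈ interior (edom φ)) {μ : ℝ} (hμ : 0 < μ)
    (h : f z + (μ : EReal) * bregman φ gφ z x ≠ ⊤) :
    (∃ a : ℝ, f z = a) ∧ ∃ b : ℝ, φ z = b := by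
  obtain ⟨c, hc⟩ := EReal.exists_coe_eq (hφbot x) (interior_subset hx)
  rw [mul_bregman_eq hx hc hμ hφbot] at h
  have hφz : φ z ≠ ⊤ := fun hz => h (by
    rw [hz, EReal.coe_mul_top_of_pos hμ, EReal.top_add_coe, EReal.add_top_of_ne_bot (hfbot z)])
  obtain ⟨b, hb⟩ := EReal.exists_coe_eq (hφbot z) hφz
  refine ⟨EReal.exists_coe_eq (hfbot z) fun hz => h ?_, b, hb⟩
  rw [hz, hb, ← EReal.coe_mul, ← EReal.coe_add, EReal.top_add_coe]

lemma exists_norm_sub_le_add_mul_bregman {n : ℕ} {φ f : EuclideanSpace ℝ (Fin n) → EReal}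
    {gφ : EuclideanSpace ℝ (Fin n) → EuclideanSpace ℝ (Fin n)} (hφ : Gamma0 φ)
    (hco : SuperCoercive φ) (hf : Gamma0 f) {x : EuclideanSpace ℝ (Fin n)}
    (hx : x ∈ interior (edom φ)) {μ : ℝ} (hμ : 0 < μ) :
    ∃ D : ℝ, ∀ z, ((‖z‖ - D : ℝ) : EReal) ≤ f z + (μ : EReal) * bregman φ gφ z x := by
  obtain ⟨c, hc⟩ := EReal.exists_coe_eq (hφ.1.1 x) (interior_subset hx)
  obtain ⟨k, d, hkd⟩ := hf.exists_norm_minorant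
  obtain ⟨D, hD⟩ := hco.exists_norm_minorant hφ (μ⁻¹ * (k + 1) + ‖gφ x‖)
  refine ⟨d + μ * (D + c + ‖gφ x‖ * ‖x‖), fun z => ?_⟩
  by_cases hz : f z + (μ : EReal) * bregman φ gφ z x = ⊤
  · rw [hz]; exact le_top
  obtain ⟨⟨a, ha⟩, b, hb⟩ := exists_coe_of_add_mul_bregman_ne_top hφ.1.1 hf.1.1 hx hμ hz
  rw [add_mul_bregman_eq hx hc ha hb, EReal.coe_le_coe_iff]
  have h1 := hkd z
  have h2 := hD z
  rw [ha, EReal.coe_le_coe_iff] at h1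
  rw [hb, EReal.coe_le_coe_iff] at h2
  have h3 : ⟪gφ x, z - x⟫ ≤ ‖gφ x‖ * (‖z‖ + ‖x‖) :=
    (real_inner_le_norm _ _).trans (mul_le_mul_of_nonneg_left (norm_sub_le z x) (norm_nonneg _))
  have h4 : μ * (μ⁻¹ * (k + 1) * ‖z‖ - D - c - ‖gφ x‖ * ‖x‖) ≤ μ * (b - c - ⟪gφ x, z - x⟫) :=
    mul_le_mul_of_nonneg_left (by linarith) hμ.le
  have h5 : μ * (μ⁻¹ * (k + 1) * ‖z‖ - D - c - ‖gφ x‖ * ‖x‖) =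
      (k + 1) * ‖z‖ - μ * (D + c + ‖gφ x‖ * ‖x‖) := by field_simp; ring
  linarith

lemma segment_bound_of_mem_bprox {n : ℕ} {φ f : EuclideanSpace ℝ (Fin n) → EReal}
    {gφ : EuclideanSpace ℝ (Fin n) → EuclideanSpace ℝ (Fin n)} {lam : ℝ} (hlam : 0 < lam)
    (hφbot : ∀ z, φ z ≠ ⊥) (hfbot : ∀ z, f z ≠ ⊥) (hf : ConvexFn f)
    {x q z : EuclideanSpace ℝ (Fin n)} (hx : x ∈ interior (edom φ))
    (hq : q ∈ bprox φ gφ lam f x) {a a' b t r : ℝ} (ha : f q = a) (hb : φ q = b)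
    (ha' : f z = a') (h0 : 0 ≤ t) (h1 : t ≤ 1) (hr : φ (q + t • (z - q)) = r) :
    b + t * (lam * (a - a') + ⟪gφ x, z - q⟫) ≤ r := by
  obtain ⟨c, hc⟩ := EReal.exists_coe_eq (hφbot x) (interior_subset hx)
  obtain ⟨s, hs, hle⟩ := hf.exists_le_segment hfbot ha ha' h0 h1
  have hmin := hq.2 (q + t • (z - q))
  rw [add_mul_bregman_eq hx hc ha hb, add_mul_bregman_eq hx hc hs hr, EReal.coe_le_coe_iff,
    show q + t • (z - q) - x = (q - x) + t • (z - q) by abel, inner_add_right,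
    inner_smul_right] at hmin
  have h2 := mul_le_mul_of_nonneg_left (hmin.trans (add_le_add_left hle _)) hlam.le
  field_simp at h2
  linarith

lemma exists_mem_bprox {n : ℕ} {φ f : EuclideanSpace ℝ (Fin n) → EReal}
    {gφ : EuclideanSpace ℝ (Fin n) → EuclideanSpace ℝ (Fin n)} {lam : ℝ} (hlam : 0 < lam)
    (hφ : Gamma0 φ) (hco : SuperCoercive φ) (hf : Gamma0 f)
    (hdom : (edom f ∩ edom φ).Nonempty) {x : EuclideanSpace ℝ (Fin n)}
    (hx : x ∈ interior (edom φ)) : (bprox φ gφ lam f x).Nonempty := by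
  have hμ : 0 < 1 / lam := by positivity
  obtain ⟨y, hyf, hyφ⟩ := hdom
  obtain ⟨a, ha⟩ := EReal.exists_coe_eq (hf.1.1 y) hyf
  obtain ⟨b, hb⟩ := EReal.exists_coe_eq (hφ.1.1 y) hyφ
  obtain ⟨c, hc⟩ := EReal.exists_coe_eq (hφ.1.1 x) (interior_subset hx)
  have hy := add_mul_bregman_eq (gφ := gφ) hx hc ha hb (1 / lam)
  obtain ⟨D, hD⟩ := exists_norm_sub_le_add_mul_bregman (gφ := gφ) hφ hco hf hx hμ
  obtain ⟨q, hq⟩ := (lowerSemicontinuous_add_mul_bregman (gφ := gφ) hφ.2.1 hφ.1.1 hf.2.1 hf.1.1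
    hx hμ).exists_forall_le_of_norm_le hy hD
  exact ⟨q, ne_top_of_le_ne_top (hy ▸ EReal.coe_ne_top _) (hq y), hq⟩

/-- First-order optimality condition for the left Bregman proximal map. -/
lemma IsLegendre.subgradient_of_mem_bprox {n : ℕ} {φ f : EuclideanSpace ℝ (Fin n) → EReal}
    {gφ : EuclideanSpace ℝ (Fin n) → EuclideanSpace ℝ (Fin n)} (hφ : IsLegendre φ gφ)
    {lam : ℝ} (hlam : 0 < lam) (hf : Gamma0 f)
    (hdom : (edom f ∩ interior (edom φ)).Nonempty) {x q : EuclideanSpace ℝ (Fin n)}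
    (hx : x ∈ interior (edom φ)) (hq : q ∈ bprox φ gφ lam f x) :
    q ∈ interior (edom φ) ∧ (1 / lam) • (gφ x - gφ q) ∈ subdiff f q := by
  have hbot := hφ.proper.1
  obtain ⟨⟨a, ha⟩, b, hb⟩ :=
    exists_coe_of_add_mul_bregman_ne_top hbot hf.1.1 hx (by positivity) hq.1
  have hqU : q ∈ interior (edom φ) := by
    obtain ⟨y, hyf, hyU⟩ := hdom
    obtain ⟨a', ha'⟩ := EReal.exists_coe_eq (hf.1.1 y) hyf
    exact hφ.mem_interior_of_segment_bound hyU hb fun t r h0 h1 hr =>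
      segment_bound_of_mem_bprox hlam hbot hf.1.1 hf.2.2 hx hq ha hb ha' h0.le h1 hr
  refine ⟨hqU, (mem_subdiff_iff hf.1.1 ha).2 fun z a' ha' => ?_⟩
  have key : lam * (a - a') + ⟪gφ x, z - q⟫ ≤ ⟪gφ q, z - q⟫ := by
    refine (hφ.grad q hqU).le_inner_of_eventually ?_
    have ht : Filter.Tendsto (fun t : ℝ => q + t • (z - q)) (𝓝[>] 0) (𝓝 q) := by
      have : Continuous (fun t : ℝ => q + t • (z - q)) := by fun_prop
      simpa using (this.tendsto 0).mono_left nhdsWithin_le_nhds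
    filter_upwards [ht.eventually (isOpen_interior.mem_nhds hqU),
      Ioc_mem_nhdsGT (zero_lt_one' ℝ)] with t htU ht
    obtain ⟨r, hr⟩ := EReal.exists_coe_eq (hbot _) (interior_subset htU)
    have := segment_bound_of_mem_bprox hlam hbot hf.1.1 hf.2.2 hx hq ha hb ha' ht.1.le ht.2 hr
    simp only [hr, hb, EReal.toReal_coe]
    linarith
  rw [real_inner_smul_left, inner_sub_left]
  have h2 : 1 / lam * (lam * (a - a')) ≤ 1 / lam * (⟪gφ q, z - q⟫ - ⟪gφ x, z - q⟫) :=
    mul_le_mul_of_nonneg_left (by linarith) (by positivity)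
  rw [← mul_assoc, one_div_mul_cancel hlam.ne'] at h2
  linarith

lemma epiMul_one_div_apply {n : ℕ} (g : EuclideanSpace ℝ (Fin n) → EReal) {lam : ℝ}
    (hlam : 0 < lam) (v y : EuclideanSpace ℝ (Fin n)) :
    epiMul (1 / lam) g ((1 / lam) • v - y) = ((1 / lam : ℝ) : EReal) * g (v - lam • y) := by
  rw [epiMul, if_pos (by positivity), one_div_one_div, smul_sub, smul_smul,
    mul_one_div_cancel hlam.ne', one_smul]

lemma aprox_eq_singleton {n : ℕ} {φ f : EuclideanSpace ℝ (Fin n) → EReal}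
    {gφ : EuclideanSpace ℝ (Fin n) → EuclideanSpace ℝ (Fin n)} (hφ : IsLegendre φ gφ)
    (hfbot : ∀ z, f z ≠ ⊥) {lam : ℝ} (hlam : 0 < lam) {v p q : EuclideanSpace ℝ (Fin n)}
    (hqU : q ∈ interior (edom φ)) {a : ℝ} (ha : f q = a) (hp : p ∈ subdiff f q)
    (hv : v - lam • p = gφ q) :
    aprox (epiMul (1 / lam) (fconj φ)) (fconj f) ((1 / lam) • v) = {p} := by
  have hbot := hφ.proper.1
  obtain ⟨b, hb⟩ := EReal.exists_coe_eq (hbot q) (interior_subset hqU)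
  have hp1 := (fconj_eq_iff_mem_subdiff hfbot ha).2 hp
  have hp2 := (fconj_eq_iff_mem_subdiff hbot hb).2 (hφ.gradient_mem_subdiff hqU)
  rw [← hv] at hp2
  have hval : fconj f p + ((1 / lam : ℝ) : EReal) * fconj φ (v - lam • p) =
      ((1 / lam * (⟪v, q⟫ - b) - a : ℝ) : EReal) := by
    rw [hp1, hp2]
    norm_cast
    rw [inner_sub_left, real_inner_smul_left]
    field_simp
    ring
  have hlow : ∀ y, (((⟪y, q⟫ - a) + 1 / lam * (⟪v - lam • y, q⟫ - b) : ℝ) : EReal) =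
      ((1 / lam * (⟪v, q⟫ - b) - a : ℝ) : EReal) := by
    intro y
    norm_cast
    rw [inner_sub_left, real_inner_smul_left]
    field_simp
    ring
  have hmul : ∀ y, ((1 / lam * (⟪v - lam • y, q⟫ - b) : ℝ) : EReal) ≤
      ((1 / lam : ℝ) : EReal) * fconj φ (v - lam • y) := fun y => by
    rw [EReal.coe_mul]
    exact mul_le_mul_of_nonneg_left (le_fconj hb _) (EReal.coe_nonneg.2 (by positivity))
  have hmin : ∀ y, ((1 / lam * (⟪v, q⟫ - b) - a : ℝ) : EReal) ≤
      fconj f y + ((1 / lam : ℝ) : EReal) * fconj φ (v - lam • y) := fun y => by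
    rw [← hlow y, EReal.coe_add]
    exact add_le_add (le_fconj ha y) (hmul y)
  ext y
  simp only [aprox, epiMul_one_div_apply _ hlam, Set.mem_ofPred_eq, Set.mem_singleton_iff]
  constructor
  · rintro ⟨-, hy⟩
    have hyp := (hy p).trans_eq hval
    have hle : fconj φ (v - lam • y) ≤ ((⟪v - lam • y, q⟫ - b : ℝ) : EReal) := by
      by_contra! hlt
      have h1 : ((1 / lam * (⟪v - lam • y, q⟫ - b) : ℝ) : EReal) <
          ((1 / lam : ℝ) : EReal) * fconj φ (v - lam • y) := by
        by_cases htop : fconj φ (v - lam • y) = ⊤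
        · rw [htop, EReal.coe_mul_top_of_pos (by positivity)]
          exact EReal.coe_lt_top _
        · obtain ⟨s, hs⟩ := EReal.exists_coe_eq (ne_bot_of_gt hlt) htop
          rw [hs, EReal.coe_lt_coe_iff] at hlt
          rw [hs, ← EReal.coe_mul, EReal.coe_lt_coe_iff]
          exact mul_lt_mul_of_pos_left hlt (by positivity)
      have h2 := (add_le_add_left (le_fconj ha y) _).trans hyp
      rw [← hlow y, EReal.coe_add] at h2
      exact absurd h2 (not_le.2 (EReal.add_lt_add_left_coe h1 _))
    have hsub := (fconj_eq_iff_mem_subdiff hbot hb).1 (le_antisymm hle (le_fconj hb _))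
    have hyq := hφ.eq_gradient_of_mem_subdiff hqU hsub
    rw [← hv, sub_right_inj] at hyq
    exact smul_right_injective _ hlam.ne' hyq
  · rintro rfl
    rw [hval]
    exact ⟨EReal.coe_ne_top _, hmin⟩

lemma mem_subdiff_of_mem_bprox {n : ℕ} {φ f : EuclideanSpace ℝ (Fin n) → EReal}
    {gφ : EuclideanSpace ℝ (Fin n) → EuclideanSpace ℝ (Fin n)} (hφbot : ∀ z, φ z ≠ ⊥)
    (hfbot : ∀ z, f z ≠ ⊥) {lam : ℝ} (hlam : 0 < lam) {x q p q' : EuclideanSpace ℝ (Fin n)}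
    (hx : x ∈ interior (edom φ)) (hq : q ∈ bprox φ gφ lam f x) (hp : p ∈ subdiff f q)
    (hv : gφ x - lam • p ∈ subdiff φ q) (hq' : q' ∈ bprox φ gφ lam f x) :
    gφ x - lam • p ∈ subdiff φ q' := by
  have hμ : 0 < 1 / lam := by positivity
  obtain ⟨c, hc⟩ := EReal.exists_coe_eq (hφbot x) (interior_subset hx)
  obtain ⟨⟨a, ha⟩, b, hb⟩ := exists_coe_of_add_mul_bregman_ne_top hφbot hfbot hx hμ hq.1
  obtain ⟨⟨a', ha'⟩, b', hb'⟩ := exists_coe_of_add_mul_bregman_ne_top hφbot hfbot hx hμ hq'.1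
  have hv' := (mem_subdiff_iff hφbot hb).1 hv
  have h1 := (mem_subdiff_iff hfbot ha).1 hp q' a' ha'
  have h2 := hq'.2 q
  rw [add_mul_bregman_eq hx hc ha hb, add_mul_bregman_eq hx hc ha' hb', EReal.coe_le_coe_iff]
    at h2
  have h3 : b' ≤ b + ⟪gφ x - lam • p, q' - q⟫ := by
    have h4 : ⟪gφ x, q' - x⟫ = ⟪gφ x, q - x⟫ + ⟪gφ x, q' - q⟫ := by
      rw [← inner_add_right]; congr 1; abel
    have h5 := mul_le_mul_of_nonneg_left h2 hlam.le
    have h6 := mul_le_mul_of_nonneg_left h1 hlam.le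
    field_simp at h5
    rw [inner_sub_left, real_inner_smul_left]
    linarith
  refine (mem_subdiff_iff hφbot hb').2 fun y s hs => ?_
  have h7 := hv' y s hs
  have h8 : ⟪gφ x - lam • p, y - q⟫ =
      ⟪gφ x - lam • p, q' - q⟫ + ⟪gφ x - lam • p, y - q'⟫ := by
    rw [← inner_add_right]; congr 1; abel
  linarith

theorem bprox_via_aniso_prox {n : ℕ}
    (φ : EuclideanSpace ℝ (Fin n) → EReal)
    (gφ : EuclideanSpace ℝ (Fin n) → EuclideanSpace ℝ (Fin n))
    (hφ : IsLegendre φ gφ) (hφco : SuperCoercive φ)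
    (gconj : EuclideanSpace ℝ (Fin n) → EuclideanSpace ℝ (Fin n))
    (hgconj : ∀ y, HasGradientAt (fun z => (fconj φ z).toReal) (gconj y) y)
    (f : EuclideanSpace ℝ (Fin n) → EReal) (hf : Gamma0 f)
    (hri : (intrinsicInterior ℝ (edom f) ∩ interior (edom φ)).Nonempty)
    (lam : ℝ) (hlam : 0 < lam) :
    ∀ x ∈ interior (edom φ), ∃ p : EuclideanSpace ℝ (Fin n),
      aprox (epiMul (1 / lam) (fconj φ)) (fconj f) ((1 / lam) • gφ x) = {p} ∧
      bprox φ gφ lam f x = {gconj (gφ x - lam • p)} ∧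
      ∀ q ∈ bprox φ gφ lam f x, gφ q + lam • p = gφ x := by
  intro x hx
  have hφ0 : Gamma0 φ := ⟨hφ.proper, hφ.lsc, hφ.convex⟩
  have hdom : (edom f ∩ interior (edom φ)).Nonempty :=
    hri.mono (Set.inter_subset_inter_left _ intrinsicInterior_subset)
  obtain ⟨q, hq⟩ := exists_mem_bprox (gφ := gφ) hlam hφ0 hφco hf
    (hdom.mono (Set.inter_subset_inter_right _ interior_subset)) hx
  obtain ⟨hqU, hp⟩ := hφ.subgradient_of_mem_bprox hlam hf hdom hx hq
  obtain ⟨⟨a, ha⟩, -⟩ :=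
    exists_coe_of_add_mul_bregman_ne_top hφ.proper.1 hf.1.1 hx (by positivity) hq.1
  set p := (1 / lam) • (gφ x - gφ q) with hp_def
  have hv : gφ x - lam • p = gφ q := by
    rw [hp_def, smul_smul, mul_one_div_cancel hlam.ne', one_smul, sub_sub_cancel]
  have huniq : ∀ q' ∈ bprox φ gφ lam f x, q' = gconj (gφ x - lam • p) := by
    intro q' hq'
    obtain ⟨-, b, hb⟩ :=
      exists_coe_of_add_mul_bregman_ne_top hφ.proper.1 hf.1.1 hx (by positivity) hq'.1
    exact hφco.eq_gradient_fconj hφ0 hb (mem_subdiff_of_mem_bprox hφ.proper.1 hf.1.1 hlam hx hq hp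
      (hv ▸ hφ.gradient_mem_subdiff hqU) hq') (hgconj _)
  refine ⟨p, aprox_eq_singleton hφ hf.1.1 hlam hqU ha hp hv, ?_, ?_⟩
  · exact Set.eq_singleton_iff_unique_mem.2 ⟨huniq q hq ▸ hq, huniq⟩
  · intro q' hq'
    rw [huniq q' hq', ← huniq q hq, ← hv, sub_add_cancel]

end
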